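/- arXiv:1605.04234 — 2 statements merged into one kernel-verified Lean document; each statement's English description precedes it below -/
import Mathlib

section
/- Let Λ: ℝ² → ℝ be continuously differentiable, positive and doubly periodic, and let a₀, a₁, a₂: ℝ² → ℝ be continuously differentiable doubly periodic functions satisfying the four equations: (a₀)_x/Λ − a₀(1/Λ)_x − a₁(1/Λ)_y = 0; (a₀)_y/Λ + 2(a₁)_x/Λ − a₁(1/Λ)_x − a₂(1/Λ)_y = 0; (a₂)_x/Λ + 2(a₁)_y/Λ − a₀(1/Λ)_x − a₁(1/Λ)_y = 0; (a₂)_y/Λ − a₁(1/Λ)_x − a₂(1/Λ)_y = 0. Then a₁ is a constant function and a₀ − a₂ is a constant function. -/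
open Set

/-- Partial derivative in the first variable. -/
noncomputable def pX (h : ℝ × ℝ → ℝ) (p : ℝ × ℝ) : ℝ := fderiv ℝ h p (1, 0)

/-- Partial derivative in the second variable. -/
noncomputable def pY (h : ℝ × ℝ → ℝ) (p : ℝ × ℝ) : ℝ := fderiv ℝ h p (0, 1)

/-- A function on `ℝ²` is doubly periodic if it is `1`-periodic in each variable. -/
def DoublyPeriodic (h : ℝ × ℝ → ℝ) : Prop :=
  ∀ x y : ℝ, h (x + 1, y) = h (x, y) ∧ h (x, y + 1) = h (x, y)

theorem pX_sub {f g : ℝ × ℝ → ℝ} {p : ℝ × ℝ} (hf : DifferentiableAt ℝ f p)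
    (hg : DifferentiableAt ℝ g p) : pX (fun q => f q - g q) p = pX f p - pX g p := by
  simp [pX, fderiv_fun_sub hf hg]

theorem pY_sub {f g : ℝ × ℝ → ℝ} {p : ℝ × ℝ} (hf : DifferentiableAt ℝ f p)
    (hg : DifferentiableAt ℝ g p) : pY (fun q => f q - g q) p = pY f p - pY g p := by
  simp [pY, fderiv_fun_sub hf hg]

theorem pX_const_mul {f : ℝ × ℝ → ℝ} {p : ℝ × ℝ} (hf : DifferentiableAt ℝ f p) (c : ℝ) :
    pX (fun q => c * f q) p = c * pX f p := by
  simp [pX, fderiv_const_mul hf]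

theorem pY_const_mul {f : ℝ × ℝ → ℝ} {p : ℝ × ℝ} (hf : DifferentiableAt ℝ f p) (c : ℝ) :
    pY (fun q => c * f q) p = c * pY f p := by
  simp [pY, fderiv_const_mul hf]

theorem DoublyPeriodic.apply_fract {h : ℝ × ℝ → ℝ} (hh : DoublyPeriodic h) (x y : ℝ) :
    h (Int.fract x, Int.fract y) = h (x, y) := by
  have hx : Function.Periodic (fun t => h (t, Int.fract y)) 1 := fun t => (hh t _).1
  have hy : Function.Periodic (fun t => h (x, t)) 1 := fun t => (hh x t).2
  have h₁ := hx.sub_int_mul_eq (x := x) ⌊x⌋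
  have h₂ := hy.sub_int_mul_eq (x := y) ⌊y⌋
  simp only [mul_one, Int.self_sub_floor] at h₁ h₂
  rw [h₁, h₂]

/-- A continuous doubly periodic function is bounded. -/
theorem DoublyPeriodic.exists_abs_le {h : ℝ × ℝ → ℝ} (hh : DoublyPeriodic h)
    (hc : Continuous h) : ∃ C, ∀ p, |h p| ≤ C := by
  obtain ⟨C, hC⟩ := (isCompact_Icc (a := ((0, 0) : ℝ × ℝ)) (b := (1, 1))
    ).exists_bound_of_continuousOn hc.continuousOn
  refine ⟨C, fun ⟨x, y⟩ => ?_⟩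
  rw [← hh.apply_fract]
  exact hC _ ⟨⟨Int.fract_nonneg x, Int.fract_nonneg y⟩,
    ⟨(Int.fract_lt_one x).le, (Int.fract_lt_one y).le⟩⟩

/-- If `u` and `v` satisfy the Cauchy–Riemann equations, then `u + iv` is holomorphic. -/
theorem differentiable_complex_of_cauchyRiemann {u v : ℝ × ℝ → ℝ}
    (hu : Differentiable ℝ u) (hv : Differentiable ℝ v)
    (h₁ : ∀ p, pX u p = pY v p) (h₂ : ∀ p, pY u p = -pX v p) :
    Differentiable ℂ fun z : ℂ => (u (z.re, z.im) : ℂ) + v (z.re, z.im) * Complex.I := by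
  intro z
  have hL := Complex.equivRealProdCLM.hasFDerivAt (x := z)
  have hu' := Complex.ofRealCLM.hasFDerivAt.comp z ((hu (z.re, z.im)).hasFDerivAt.comp z hL)
  have hv' := Complex.ofRealCLM.hasFDerivAt.comp z ((hv (z.re, z.im)).hasFDerivAt.comp z hL)
  have hf := hu'.add (hv'.mul_const Complex.I)
  refine (hf.complexOfReal_hasFDerivAt ?_).differentiableAt
  have hf₁ := h₁ (z.re, z.im)
  have hf₂ := h₂ (z.re, z.im)
  simp only [pX, pY] at hf₁ hf₂
  apply Complex.ext <;> simp [hf₁, hf₂]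

/-- Doubly periodic solutions of the Cauchy–Riemann equations are constant. -/
theorem exists_const_of_cauchyRiemann_of_doublyPeriodic {u v : ℝ × ℝ → ℝ}
    (hu : Differentiable ℝ u) (hv : Differentiable ℝ v)
    (hup : DoublyPeriodic u) (hvp : DoublyPeriodic v)
    (h₁ : ∀ p, pX u p = pY v p) (h₂ : ∀ p, pY u p = -pX v p) :
    (∃ c, ∀ p, u p = c) ∧ ∃ c, ∀ p, v p = c := by
  obtain ⟨A, hA⟩ := hup.exists_abs_le hu.continuous
  obtain ⟨B, hB⟩ := hvp.exists_abs_le hv.continuous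
  have hf := differentiable_complex_of_cauchyRiemann hu hv h₁ h₂
  obtain ⟨c, hc⟩ := hf.exists_const_forall_eq_of_bounded
    (isBounded_iff_forall_norm_le.2 ⟨A + B, by
      rintro _ ⟨z, rfl⟩
      refine (norm_add_le _ _).trans (add_le_add ?_ ?_)
      · simpa using hA _
      · simpa using hB _⟩)
  refine ⟨⟨c.re, fun ⟨x, y⟩ => ?_⟩, ⟨c.im, fun ⟨x, y⟩ => ?_⟩⟩
  · simpa using congrArg Complex.re (hc ⟨x, y⟩)
  · simpa using congrArg Complex.im (hc ⟨x, y⟩)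

/-- The group (a) of equations on the leading coefficients
`a₀, a₁, a₂` of a quadratic integral (the same as for geodesic flows without magnetic
field) forces `a₁` and `a₀ - a₂` to be constant. -/
theorem statement9
    (Λ a₀ a₁ a₂ : ℝ × ℝ → ℝ)
    (hΛ : ContDiff ℝ 1 Λ) (ha₀ : ContDiff ℝ 1 a₀) (ha₁ : ContDiff ℝ 1 a₁)
    (ha₂ : ContDiff ℝ 1 a₂)
    (hΛpos : ∀ p : ℝ × ℝ, 0 < Λ p)
    (hΛper : DoublyPeriodic Λ) (ha₀per : DoublyPeriodic a₀)
    (ha₁per : DoublyPeriodic a₁) (ha₂per : DoublyPeriodic a₂)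
    (ha1 : ∀ p : ℝ × ℝ, pX a₀ p / Λ p - a₀ p * pX (fun q => 1 / Λ q) p
      - a₁ p * pY (fun q => 1 / Λ q) p = 0)
    (ha2 : ∀ p : ℝ × ℝ, pY a₀ p / Λ p + 2 * pX a₁ p / Λ p
      - a₁ p * pX (fun q => 1 / Λ q) p - a₂ p * pY (fun q => 1 / Λ q) p = 0)
    (ha3 : ∀ p : ℝ × ℝ, pX a₂ p / Λ p + 2 * pY a₁ p / Λ p
      - a₀ p * pX (fun q => 1 / Λ q) p - a₁ p * pY (fun q => 1 / Λ q) p = 0)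
    (ha4 : ∀ p : ℝ × ℝ, pY a₂ p / Λ p - a₁ p * pX (fun q => 1 / Λ q) p
      - a₂ p * pY (fun q => 1 / Λ q) p = 0) :
    (∃ c : ℝ, ∀ p : ℝ × ℝ, a₁ p = c) ∧ (∃ c : ℝ, ∀ p : ℝ × ℝ, a₀ p - a₂ p = c) := by
  have hCR₁ : ∀ p, pX (fun q => a₀ q - a₂ q) p = pY (fun q => 2 * a₁ q) p := fun p => by
    have hΛ₀ := (hΛpos p).ne'
    rw [pX_sub (ha₀.differentiable one_ne_zero p) (ha₂.differentiable one_ne_zero p),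
      pY_const_mul (ha₁.differentiable one_ne_zero p)]
    have h : (pX a₀ p - pX a₂ p - 2 * pY a₁ p) / Λ p = 0 := by
      linear_combination ha1 p - ha3 p
    linarith [(div_eq_zero_iff.mp h).resolve_right hΛ₀]
  have hCR₂ : ∀ p, pY (fun q => a₀ q - a₂ q) p = -pX (fun q => 2 * a₁ q) p := fun p => by
    have hΛ₀ := (hΛpos p).ne'
    rw [pY_sub (ha₀.differentiable one_ne_zero p) (ha₂.differentiable one_ne_zero p),
      pX_const_mul (ha₁.differentiable one_ne_zero p)]
    have h : (pY a₀ p - pY a₂ p + 2 * pX a₁ p) / Λ p = 0 := by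
      linear_combination ha2 p - ha4 p
    linarith [(div_eq_zero_iff.mp h).resolve_right hΛ₀]
  have hu : DoublyPeriodic fun q => a₀ q - a₂ q := fun x y => by
    simp [ha₀per x y, ha₂per x y]
  have hv : DoublyPeriodic fun q => 2 * a₁ q := fun x y => by simp [ha₁per x y]
  obtain ⟨⟨c, hc⟩, d, hd⟩ := exists_const_of_cauchyRiemann_of_doublyPeriodic
    ((ha₀.sub ha₂).differentiable one_ne_zero)
    ((contDiff_const.mul ha₁).differentiable one_ne_zero) hu hv hCR₁ hCR₂
  exact ⟨⟨d / 2, fun p => by linarith [hd p]⟩, c, hc⟩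
end

section
/- Let φ, ψ: ℝ → ℝ be continuously differentiable 1-periodic functions with φ(y) − ψ(x) > 0 for all x,y, and set Λ(x,y) = (φ(y) − ψ(x))/4. Let f, g: ℝ² → ℝ be continuously differentiable doubly periodic functions satisfying 2Λf_x + Λ_x f − Λ_y g = 0 and f_x + g_y = 0, and suppose f·g is a constant function. If Λ is nonconstant, then f·g ≡ 0. -/
open Set

theorem hasDerivAt_fst_slice {h : ℝ × ℝ → ℝ} (hh : Differentiable ℝ h) (x y : ℝ) :
    HasDerivAt (fun t => h (t, y)) (pX h (x, y)) x :=
  (hh (x, y)).hasFDerivAt.comp_hasDerivAt x ((hasDerivAt_id x).prodMk (hasDerivAt_const x y))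

theorem hasDerivAt_snd_slice {h : ℝ × ℝ → ℝ} (hh : Differentiable ℝ h) (x y : ℝ) :
    HasDerivAt (fun t => h (x, t)) (pY h (x, y)) y :=
  (hh (x, y)).hasFDerivAt.comp_hasDerivAt y ((hasDerivAt_const y x).prodMk (hasDerivAt_id y))

/-- A periodic function with constant derivative has zero derivative. -/
theorem eq_zero_of_periodic_of_hasDerivAt_const {F : ℝ → ℝ} {c : ℝ}
    (hF : ∀ t, HasDerivAt F c t) (hper : Function.Periodic F 1) : c = 0 := by
  obtain ⟨_, _, hc⟩ := exists_hasDerivAt_eq_zero (f := F) (f' := fun _ => c) zero_lt_one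
    (fun t _ => (hF t).continuousAt.continuousWithinAt)
    (by simpa using (hper 0).symm) (fun t _ => hF t)
  exact hc

/-- Elimination of the constant `K₂ = f·g`: if `Λ` is a nonconstant
Liouville factor `Λ = (φ(y) - ψ(x))/4` and `f, g` are doubly periodic with (b1'), (b2')
and `f·g` constant, then `f·g ≡ 0`. -/
theorem statement13
    (φ ψ : ℝ → ℝ)
    (hφ : ContDiff ℝ 1 φ) (hψ : ContDiff ℝ 1 ψ)
    (hφper : Function.Periodic φ 1) (hψper : Function.Periodic ψ 1)
    (hpos : ∀ x y : ℝ, 0 < φ y - ψ x)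
    (Λ : ℝ × ℝ → ℝ) (hΛdef : ∀ p : ℝ × ℝ, Λ p = (φ p.2 - ψ p.1) / 4)
    (f g : ℝ × ℝ → ℝ)
    (hf : ContDiff ℝ 1 f) (hg : ContDiff ℝ 1 g)
    (hfper : DoublyPeriodic f) (hgper : DoublyPeriodic g)
    (hb1 : ∀ p : ℝ × ℝ, 2 * Λ p * pX f p + pX Λ p * f p - pY Λ p * g p = 0)
    (hb2 : ∀ p : ℝ × ℝ, pX f p + pY g p = 0)
    (K₂ : ℝ) (hK₂ : ∀ p : ℝ × ℝ, f p * g p = K₂)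
    (hΛnc : ∃ p q : ℝ × ℝ, Λ p ≠ Λ q) :
    ∀ p : ℝ × ℝ, f p * g p = 0 := by
  by_contra hne
  have hK : K₂ ≠ 0 := fun h0 => hne fun p => (hK₂ p).trans h0
  obtain rfl : Λ = fun p => (φ p.2 - ψ p.1) / 4 := funext hΛdef
  have hφd : Differentiable ℝ φ := hφ.differentiable one_ne_zero
  have hψd : Differentiable ℝ ψ := hψ.differentiable one_ne_zero
  have hfd : Differentiable ℝ f := hf.differentiable one_ne_zero
  have hgd : Differentiable ℝ g := hg.differentiable one_ne_zero
  have hΛd : Differentiable ℝ fun p : ℝ × ℝ => (φ p.2 - ψ p.1) / 4 := by fun_prop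
  have hΛx (x y : ℝ) : pX (fun p : ℝ × ℝ => (φ p.2 - ψ p.1) / 4) (x, y) = -deriv ψ x / 4 :=
    (hasDerivAt_fst_slice hΛd x y).unique
      (((hψd x).hasDerivAt.const_sub (φ y)).div_const 4)
  have hΛy (x y : ℝ) : pY (fun p : ℝ × ℝ => (φ p.2 - ψ p.1) / 4) (x, y) = deriv φ y / 4 :=
    (hasDerivAt_snd_slice hΛd x y).unique
      (((hφd y).hasDerivAt.sub_const (ψ x)).div_const 4)
  have hφ' (y : ℝ) : deriv φ y = 0 := by
    have h : K₂ * (deriv φ y / 4) = 0 := by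
      refine eq_zero_of_periodic_of_hasDerivAt_const
        (F := fun t => f (t, y) ^ 2 * ((φ y - ψ t) / 4)) (fun x => ?_) (fun x => ?_)
      · refine (((hasDerivAt_fst_slice hfd x y).pow 2).mul
          (hasDerivAt_fst_slice hΛd x y)).congr_deriv ?_
        have h1 := hb1 (x, y)
        rw [hΛy] at h1
        simp only [Nat.cast_ofNat, Nat.add_one_sub_one, pow_one, Pi.pow_apply] at h1 ⊢
        linear_combination f (x, y) * h1 + deriv φ y / 4 * hK₂ (x, y)
      · simp only [(hfper x y).1, hψper x]
    simpa [hK] using h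
  have hψ' (x : ℝ) : deriv ψ x = 0 := by
    have h : K₂ * (-deriv ψ x / 4) = 0 := by
      refine eq_zero_of_periodic_of_hasDerivAt_const
        (F := fun t => g (x, t) ^ 2 * ((φ t - ψ x) / 4)) (fun y => ?_) (fun y => ?_)
      · refine (((hasDerivAt_snd_slice hgd x y).pow 2).mul
          (hasDerivAt_snd_slice hΛd x y)).congr_deriv ?_
        have h1 := hb1 (x, y)
        rw [hΛx] at h1
        simp only [Nat.cast_ofNat, Nat.add_one_sub_one, pow_one, Pi.pow_apply] at h1 ⊢
        linear_combination -g (x, y) * h1 - deriv ψ x / 4 * hK₂ (x, y) +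
          2 * ((φ y - ψ x) / 4) * g (x, y) * hb2 (x, y)
      · simp only [(hgper x y).2, hφper y]
    simpa [hK] using h
  obtain ⟨p, q, hpq⟩ := hΛnc
  refine hpq ?_
  simp only [is_const_of_deriv_eq_zero hφd hφ' p.2 q.2,
    is_const_of_deriv_eq_zero hψd hψ' p.1 q.1]
end
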